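/- arXiv:1107.2616 — 2 statements merged into one kernel-verified Lean document; each statement's English description precedes it below -/
import Mathlib

section
/- The gradient of the projection π_P vanishes at infinity: for every ε > 0 there exists M > 0 such that for every η ∈ ℝ^d with |η| > M (and all coordinates nonzero, so that the derivatives exist), one has |∂_{η_j} π_k(η)| ≤ ε for all j,k = 1,…,d. -/
/- STATEMENT 4: the gradient of the projection `π_P` vanishes at infinity: for every
`ε > 0` there is `M > 0` such that `|∂_{η_j} π_k(η)| ≤ ε` whenever the Euclidean norm
`|η| > M` (with all coordinates of `η` nonzero, so that the derivatives exist). -/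

open scoped Real

noncomputable section

def Sfun {d : ℕ} (α : Fin d → ℝ) (l : ℕ) (ξ : Fin d → ℝ) : ℝ :=
  ∑ k, |ξ k| ^ ((l : ℝ) * α k)

def piP {d : ℕ} (α : Fin d → ℝ) (l : ℕ) (ξ : Fin d → ℝ) : Fin d → ℝ :=
  fun k => ξ k / (Sfun α l ξ) ^ (1 / ((l : ℝ) * α k))

theorem Sfun_pos {d : ℕ} (α : Fin d → ℝ) (l : ℕ) {η : Fin d → ℝ} {k : Fin d} (hk : η k ≠ 0) :
    0 < Sfun α l η :=
  Finset.sum_pos' (fun _ _ => Real.rpow_nonneg (abs_nonneg _) _)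
    ⟨k, Finset.mem_univ k, Real.rpow_pos_of_pos (abs_pos.2 hk) _⟩

theorem abs_rpow_le_Sfun {d : ℕ} (α : Fin d → ℝ) (l : ℕ) (η : Fin d → ℝ) (k : Fin d) :
    |η k| ^ ((l : ℝ) * α k) ≤ Sfun α l η :=
  Finset.single_le_sum (f := fun i => |η i| ^ ((l : ℝ) * α i))
    (fun _ _ => Real.rpow_nonneg (abs_nonneg _) _) (Finset.mem_univ k)

theorem abs_le_Sfun_rpow {d : ℕ} (α : Fin d → ℝ) (l : ℕ) (η : Fin d → ℝ) (k : Fin d)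
    (hp : 0 < (l : ℝ) * α k) : |η k| ≤ Sfun α l η ^ (1 / ((l : ℝ) * α k)) := by
  rw [one_div]
  exact (Real.le_rpow_inv_iff_of_pos (abs_nonneg _)
    ((Real.rpow_nonneg (abs_nonneg _) _).trans (abs_rpow_le_Sfun α l η k)) hp).2
    (abs_rpow_le_Sfun α l η k)

theorem hasFDerivAt_Sfun {d : ℕ} (α : Fin d → ℝ) (l : ℕ) (hp : ∀ k, 1 < (l : ℝ) * α k)
    (η : Fin d → ℝ) :
    HasFDerivAt (Sfun α l)
      (∑ k, ((l : ℝ) * α k * |η k| ^ ((l : ℝ) * α k - 2) * η k) •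
        (ContinuousLinearMap.proj k : (Fin d → ℝ) →L[ℝ] ℝ)) η := by
  unfold Sfun
  refine HasFDerivAt.fun_sum fun k _ => ?_
  exact (hasDerivAt_abs_rpow (η k) (hp k)).comp_hasFDerivAt η
    (ContinuousLinearMap.proj (R := ℝ) (φ := fun _ : Fin d => ℝ) k).hasFDerivAt

theorem fderiv_piP_single {d : ℕ} (α : Fin d → ℝ) (l : ℕ) (hp : ∀ k, 1 < (l : ℝ) * α k)
    {η : Fin d → ℝ} (hη : 0 < Sfun α l η) (j k : Fin d) :
    fderiv ℝ (fun ξ => piP α l ξ k) η (Pi.single j 1) =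
      (Pi.single j 1 : Fin d → ℝ) k * Sfun α l η ^ (-(1 / ((l : ℝ) * α k))) -
        η k * (1 / ((l : ℝ) * α k) * Sfun α l η ^ (-(1 / ((l : ℝ) * α k)) - 1) *
          ((l : ℝ) * α j * |η j| ^ ((l : ℝ) * α j - 2) * η j)) := by
  have hS := hasFDerivAt_Sfun α l hp η
  have h := (ContinuousLinearMap.proj (R := ℝ) (φ := fun _ : Fin d => ℝ) k).hasFDerivAt.fun_mul
    (hS.rpow_const (p := -(1 / ((l : ℝ) * α k))) (Or.inl hη.ne'))
  have heq : (fun ξ => piP α l ξ k) =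
      fun ξ => ξ k * Sfun α l ξ ^ (-(1 / ((l : ℝ) * α k))) := by
    funext ξ
    have h0 : 0 ≤ Sfun α l ξ := Finset.sum_nonneg fun i _ => Real.rpow_nonneg (abs_nonneg _) _
    rw [piP, Real.rpow_neg h0, div_eq_mul_inv]
  have hL : (∑ i, ((l : ℝ) * α i * |η i| ^ ((l : ℝ) * α i - 2) * η i) •
      (ContinuousLinearMap.proj i : (Fin d → ℝ) →L[ℝ] ℝ)) (Pi.single j 1) =
      (l : ℝ) * α j * |η j| ^ ((l : ℝ) * α j - 2) * η j := by
    simp [Pi.single_apply]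
  rw [heq]
  refine (congrArg (fun L => L (Pi.single j 1)) h.fderiv).trans ?_
  simp only [add_apply, smul_apply, hL,
    ContinuousLinearMap.proj_apply, smul_eq_mul]
  ring

theorem abs_fderiv_piP_single_le {d : ℕ} (α : Fin d → ℝ) (l : ℕ)
    (hp : ∀ k, 1 < (l : ℝ) * α k) {η : Fin d → ℝ} (hη : ∀ i, η i ≠ 0) (j k : Fin d) :
    |fderiv ℝ (fun ξ => piP α l ξ k) η (Pi.single j 1)| ≤
      Sfun α l η ^ (-(1 / ((l : ℝ) * α k))) +
        (l : ℝ) * α j / ((l : ℝ) * α k) * Sfun α l η ^ (-(1 / ((l : ℝ) * α j))) := by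
  have hS := Sfun_pos α l (hη k)
  rw [fderiv_piP_single α l hp hS]
  have hk := abs_le_Sfun_rpow α l η k (by linarith [hp k])
  have hj := abs_le_Sfun_rpow α l η j (by linarith [hp j])
  have hpj := hp j
  have hpk := hp k
  set S := Sfun α l η
  set p := (l : ℝ) * α j
  set q := (l : ℝ) * α k
  have hj' : |η j| ^ (p - 2) * |η j| ≤ S ^ (1 - 1 / p) := by
    have habs := abs_pos.2 (hη j)
    calc |η j| ^ (p - 2) * |η j| = |η j| ^ (p - 1) := by
          rw [← Real.rpow_add_one habs.ne']; congr 1; ring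
      _ ≤ (S ^ (1 / p)) ^ (p - 1) := by gcongr
      _ = S ^ (1 - 1 / p) := by
          rw [← Real.rpow_mul hS.le]; congr 1; field_simp
  refine (abs_sub _ _).trans (add_le_add ?_ ?_)
  · rw [abs_mul, abs_of_pos (Real.rpow_pos_of_pos hS _)]
    refine mul_le_of_le_one_left (Real.rpow_nonneg hS.le _) ?_
    by_cases h : k = j <;> simp [h]
  · have hq : 0 < q := by linarith
    have hp0 : 0 < p := by linarith
    calc |η k * (1 / q * S ^ (-(1 / q) - 1) * (p * |η j| ^ (p - 2) * η j))|
        = |η k| * (1 / q * S ^ (-(1 / q) - 1) * (p * (|η j| ^ (p - 2) * |η j|))) := by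
          simp only [abs_mul, abs_div, abs_one, abs_of_pos hq, abs_of_pos hp0,
            abs_of_pos (Real.rpow_pos_of_pos hS _), abs_of_nonneg
            (Real.rpow_nonneg (abs_nonneg (η j)) _)]
          ring
      _ ≤ S ^ (1 / q) * (1 / q * S ^ (-(1 / q) - 1) * (p * S ^ (1 - 1 / p))) := by gcongr
      _ = p / q * (S ^ (1 / q) * S ^ (-(1 / q) - 1) * S ^ (1 - 1 / p)) := by ring
      _ = p / q * S ^ (-(1 / p)) := by
          rw [← Real.rpow_add hS, ← Real.rpow_add hS]; congr 2; ring

theorem sqrt_sum_sq_le {d : ℕ} (α : Fin d → ℝ) (l : ℕ) (hp : ∀ k, 1 < (l : ℝ) * α k)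
    (η : Fin d → ℝ) : √(∑ i, η i ^ 2) ≤ d * max 1 (Sfun α l η) := by
  have hT : ∀ i, |η i| ≤ max 1 (Sfun α l η) := by
    intro i
    rcases le_total |η i| 1 with h | h
    · exact h.trans (le_max_left _ _)
    · exact ((Real.self_le_rpow_of_one_le h (hp i).le).trans
        (abs_rpow_le_Sfun α l η i)).trans (le_max_right _ _)
  calc √(∑ i, η i ^ 2) ≤ ∑ i, |η i| := by
        refine Real.sqrt_le_iff.2 ⟨Finset.sum_nonneg fun i _ => abs_nonneg _, ?_⟩
        simpa only [sq_abs] using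
          Finset.sum_sq_le_sq_sum_of_nonneg (s := Finset.univ) (f := fun i => |η i|)
            fun i _ => abs_nonneg _
    _ ≤ ∑ _i : Fin d, max 1 (Sfun α l η) := Finset.sum_le_sum fun i _ => hT i
    _ = d * max 1 (Sfun α l η) := by simp

theorem statement4 (d : ℕ) (hd : 0 < d) (α : Fin d → ℝ) (hα : ∀ k, 0 < α k)
    (l : ℕ) (hl : ∀ k, (d : ℝ) < (l : ℝ) * α k)
    (hlmin : ∀ l' : ℕ, (∀ k, (d : ℝ) < (l' : ℝ) * α k) → l ≤ l') :
    ∀ ε : ℝ, 0 < ε → ∃ M : ℝ, 0 < M ∧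
      ∀ η : Fin d → ℝ, (∀ i, η i ≠ 0) → M < Real.sqrt (∑ i, (η i) ^ 2) →
        ∀ j k : Fin d,
          |fderiv ℝ (fun ξ => piP α l ξ k) η (Pi.single j 1)| ≤ ε := by
  intro ε hε
  have hd1 : (1 : ℝ) ≤ d := by exact_mod_cast hd
  have hp : ∀ k, 1 < (l : ℝ) * α k := fun k => hd1.trans_lt (hl k)
  have hlim : ∀ j k : Fin d, Filter.Tendsto (fun S : ℝ => S ^ (-(1 / ((l : ℝ) * α k))) +
      (l : ℝ) * α j / ((l : ℝ) * α k) * S ^ (-(1 / ((l : ℝ) * α j))))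
      Filter.atTop (nhds 0) := by
    intro j k
    have h : ∀ i, Filter.Tendsto (fun S : ℝ => S ^ (-(1 / ((l : ℝ) * α i))))
        Filter.atTop (nhds 0) := fun i =>
      tendsto_rpow_neg_atTop (one_div_pos.2 (by linarith [hp i]))
    simpa using (h k).add ((h j).const_mul ((l : ℝ) * α j / ((l : ℝ) * α k)))
  have hev : ∀ᶠ S : ℝ in Filter.atTop, ∀ j k : Fin d, S ^ (-(1 / ((l : ℝ) * α k))) +
      (l : ℝ) * α j / ((l : ℝ) * α k) * S ^ (-(1 / ((l : ℝ) * α j))) ≤ ε :=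
    Filter.eventually_all.2 fun j => Filter.eventually_all.2 fun k =>
      (hlim j k).eventually_le_const hε
  obtain ⟨K, hK⟩ := Filter.eventually_atTop.1 hev
  have hd0 : (0 : ℝ) < d := by linarith
  refine ⟨d * max 1 K, by positivity, fun η hη hM j k => ?_⟩
  have hlt := lt_of_mul_lt_mul_left (hM.trans_le (sqrt_sum_sq_le α l hp η)) hd0.le
  have hKS : K ≤ Sfun α l η := by
    rcases lt_max_iff.1 hlt with h | h
    · exact absurd h (not_lt.2 (le_max_left _ _))
    · exact (le_max_right _ _).trans h.le
  exact (abs_fderiv_piP_single_le α l hp hη j k).trans (hK _ hKS j k)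

end
end

section
/- For every continuous function ψ on P and all r, ε > 0 there exists M > 0 such that whenever η_1, η_2 ∈ ℝ^d satisfy |η_1 − η_2| ≤ r and |η_1|, |η_2| > M, one has |ψ(π_P(η_1)) − ψ(π_P(η_2))| ≤ ε. -/
/- STATEMENT 5: variant of the first commutation lemma condition: for every `ψ`
continuous on `P` and all `r, ε > 0` there is `M > 0` such that
`|ψ(π_P(η₁)) − ψ(π_P(η₂))| ≤ ε` whenever `|η₁ − η₂| ≤ r` and `|η₁|, |η₂| > M`
(Euclidean norms). -/

open scoped Real

noncomputable section

section

variable {d : ℕ} {α : Fin d → ℝ} {l : ℕ}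

lemma Sfun_nonneg (ξ : Fin d → ℝ) : 0 ≤ Sfun α l ξ :=
  Finset.sum_nonneg fun _ _ => Real.rpow_nonneg (abs_nonneg _) _

lemma continuous_Sfun (ha : ∀ k, 0 < (l : ℝ) * α k) : Continuous (Sfun α l) := by
  unfold Sfun
  exact continuous_finsetSum _ fun k _ =>
    (continuous_apply k).abs.rpow_const fun _ => Or.inr (ha k).le

lemma abs_apply_le_Sfun_rpow (ha : ∀ k, 0 < (l : ℝ) * α k) (ξ : Fin d → ℝ) (k : Fin d) :
    |ξ k| ≤ Sfun α l ξ ^ (1 / ((l : ℝ) * α k)) := by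
  have h : |ξ k| ^ ((l : ℝ) * α k) ≤ Sfun α l ξ :=
    Finset.single_le_sum (f := fun k => |ξ k| ^ ((l : ℝ) * α k))
      (fun _ _ => Real.rpow_nonneg (abs_nonneg _) _) (Finset.mem_univ k)
  rw [one_div]
  exact (Real.le_rpow_inv_iff_of_pos (abs_nonneg _) (Sfun_nonneg ξ) (ha k)).2 h

/-- The anisotropic sphere is compact. -/
lemma isCompact_Sfun_eq_one (ha : ∀ k, 0 < (l : ℝ) * α k) :
    IsCompact {ξ : Fin d → ℝ | Sfun α l ξ = 1} := by
  refine (isCompact_closedBall (0 : Fin d → ℝ) 1).of_isClosed_subset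
    (isClosed_eq (continuous_Sfun ha) continuous_const) fun ξ hξ => ?_
  rw [mem_closedBall_zero_iff, pi_norm_le_iff_of_nonneg zero_le_one]
  intro k
  have h := abs_apply_le_Sfun_rpow ha ξ k
  rwa [show Sfun α l ξ = 1 from hξ, Real.one_rpow] at h

/-- Homogeneity of `Sfun` under the anisotropic dilations. -/
lemma Sfun_dilation (ha : ∀ k, 0 < (l : ℝ) * α k) {t : ℝ} (ht : 0 < t) (ξ : Fin d → ℝ) :
    Sfun α l (fun k => ξ k / t ^ (1 / ((l : ℝ) * α k))) = Sfun α l ξ / t := by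
  unfold Sfun
  rw [Finset.sum_div]
  refine Finset.sum_congr rfl fun k _ => ?_
  have hp : 0 < t ^ (1 / ((l : ℝ) * α k)) := Real.rpow_pos_of_pos ht _
  rw [abs_div, abs_of_pos hp, Real.div_rpow (abs_nonneg _) hp.le, ← Real.rpow_mul ht.le,
    one_div_mul_cancel (ha k).ne', Real.rpow_one]

/-- The projection is invariant under the anisotropic dilations. -/
lemma piP_dilation (ha : ∀ k, 0 < (l : ℝ) * α k) {t : ℝ} (ht : 0 < t) (ξ : Fin d → ℝ) :
    piP α l (fun k => ξ k / t ^ (1 / ((l : ℝ) * α k))) = piP α l ξ := by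
  funext k
  have hp : 0 < t ^ (1 / ((l : ℝ) * α k)) := Real.rpow_pos_of_pos ht _
  simp only [piP]
  rw [Sfun_dilation ha ht, Real.div_rpow (Sfun_nonneg ξ) ht.le, div_div_div_cancel_right₀ hp.ne']

lemma Sfun_piP (ha : ∀ k, 0 < (l : ℝ) * α k) {ξ : Fin d → ℝ} (h : 0 < Sfun α l ξ) :
    Sfun α l (piP α l ξ) = 1 := by
  unfold piP
  rw [Sfun_dilation ha h, div_self h.ne']

lemma continuousAt_piP (ha : ∀ k, 0 < (l : ℝ) * α k) {ξ : Fin d → ℝ} (h : 0 < Sfun α l ξ) :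
    ContinuousAt (piP α l) ξ := by
  unfold piP
  refine continuousAt_pi.2 fun k => (continuous_apply k).continuousAt.div ?_
    (Real.rpow_pos_of_pos h _).ne'
  exact (continuous_Sfun ha).continuousAt.rpow_const (Or.inl h.ne')

lemma continuousAt_comp_piP {Y : Type*} [TopologicalSpace Y] (ha : ∀ k, 0 < (l : ℝ) * α k)
    {ψ : (Fin d → ℝ) → Y} (hψ : ContinuousOn ψ {ξ | Sfun α l ξ = 1})
    {ξ : Fin d → ℝ} (h : 0 < Sfun α l ξ) : ContinuousAt (fun η => ψ (piP α l η)) ξ := by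
  have hev : ∀ᶠ η in nhds ξ, piP α l η ∈ {ξ | Sfun α l ξ = 1} :=
    ((continuous_Sfun ha).continuousAt.eventually_const_lt h).mono fun η hη => Sfun_piP ha hη
  exact (hψ _ (Sfun_piP ha h)).tendsto.comp
    (tendsto_nhdsWithin_iff.2 ⟨continuousAt_piP ha h, hev⟩)

/-- `Sfun` dominates the Euclidean norm outside of its unit ball. -/
lemma lt_Sfun_of_lt_sqrt (ha : ∀ k, 1 ≤ (l : ℝ) * α k) {T : ℝ} (hT : 1 ≤ T) {ξ : Fin d → ℝ}
    (h : √d * T < √(∑ i, ξ i ^ 2)) : T < Sfun α l ξ := by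
  contrapose! h
  have hk (k : Fin d) : ξ k ^ 2 ≤ T ^ 2 := by
    have hak : 0 < (l : ℝ) * α k := zero_lt_one.trans_le (ha k)
    rw [← sq_abs]
    refine pow_le_pow_left₀ (abs_nonneg _) ?_ 2
    calc |ξ k| ≤ Sfun α l ξ ^ (1 / ((l : ℝ) * α k)) :=
          abs_apply_le_Sfun_rpow (fun k => zero_lt_one.trans_le (ha k)) ξ k
      _ ≤ T ^ (1 / ((l : ℝ) * α k)) :=
          Real.rpow_le_rpow (Sfun_nonneg ξ) h (one_div_nonneg.2 hak.le)
      _ ≤ T ^ (1 : ℝ) := Real.rpow_le_rpow_of_exponent_le hT ((div_le_one hak).2 (ha k))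
      _ = T := Real.rpow_one T
  calc √(∑ i, ξ i ^ 2) ≤ √(∑ _i : Fin d, T ^ 2) :=
        Real.sqrt_le_sqrt (Finset.sum_le_sum fun k _ => hk k)
    _ = √d * T := by
        rw [Finset.sum_const, Finset.card_univ, Fintype.card_fin, nsmul_eq_mul,
          Real.sqrt_mul d.cast_nonneg, Real.sqrt_sq (zero_le_one.trans hT)]

end

theorem statement5 (d : ℕ) (hd : 0 < d) (α : Fin d → ℝ) (hα : ∀ k, 0 < α k)
    (l : ℕ) (hl : ∀ k, (d : ℝ) < (l : ℝ) * α k)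
    (hlmin : ∀ l' : ℕ, (∀ k, (d : ℝ) < (l' : ℝ) * α k) → l ≤ l')
    (ψ : (Fin d → ℝ) → ℂ) (hψ : ContinuousOn ψ {ξ : Fin d → ℝ | Sfun α l ξ = 1}) :
    ∀ r ε : ℝ, 0 < r → 0 < ε → ∃ M : ℝ, 0 < M ∧
      ∀ η₁ η₂ : Fin d → ℝ,
        Real.sqrt (∑ i, (η₁ i - η₂ i) ^ 2) ≤ r →
        M < Real.sqrt (∑ i, (η₁ i) ^ 2) → M < Real.sqrt (∑ i, (η₂ i) ^ 2) →
        ‖ψ (piP α l η₁) - ψ (piP α l η₂)‖ ≤ ε := by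
  intro r ε hr hε
  have ha1 (k : Fin d) : 1 ≤ (l : ℝ) * α k :=
    (Nat.one_le_cast.2 hd).trans (hl k).le
  have ha (k : Fin d) : 0 < (l : ℝ) * α k := zero_lt_one.trans_le (ha1 k)
  obtain ⟨δ, hδ, hunif⟩ := Metric.mem_uniformity_dist.1 <|
    (isCompact_Sfun_eq_one ha).uniformContinuousAt_of_continuousAt
      (fun η => ψ (piP α l η))
      (fun ξ hξ => continuousAt_comp_piP ha hψ (zero_lt_one.trans_eq (Eq.symm hξ)))
      (Metric.dist_mem_uniformity hε)
  have hpow (k : Fin d) : 0 ≤ (r / δ) ^ ((l : ℝ) * α k) := by positivity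
  set T : ℝ := 1 + ∑ k, (r / δ) ^ ((l : ℝ) * α k) with hTdef
  have hT : 1 ≤ T := le_add_of_nonneg_right (Finset.sum_nonneg fun k _ => hpow k)
  have hd' : (0 : ℝ) < d := Nat.cast_pos.2 hd
  refine ⟨√d * T, by positivity, fun η₁ η₂ hr12 h1 _ => ?_⟩
  have hTS : T < Sfun α l η₁ := lt_Sfun_of_lt_sqrt ha1 hT h1
  have hS : 0 < Sfun α l η₁ := by linarith
  have hdist : dist (piP α l η₁)
      (fun k => η₂ k / Sfun α l η₁ ^ (1 / ((l : ℝ) * α k))) < δ := by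
    refine (dist_pi_lt_iff hδ).2 fun k => ?_
    have hp : 0 < Sfun α l η₁ ^ (1 / ((l : ℝ) * α k)) := Real.rpow_pos_of_pos hS _
    have hle : |η₁ k - η₂ k| ≤ r := by
      refine le_trans (Real.abs_le_sqrt ?_) hr12
      exact Finset.single_le_sum (f := fun i => (η₁ i - η₂ i) ^ 2)
        (fun _ _ => sq_nonneg _) (Finset.mem_univ k)
    have hlt : r / δ < Sfun α l η₁ ^ (1 / ((l : ℝ) * α k)) := by
      rw [one_div, Real.lt_rpow_inv_iff_of_pos (by positivity) hS.le (ha k)]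
      have := Finset.single_le_sum (f := fun k => (r / δ) ^ ((l : ℝ) * α k))
        (fun k _ => hpow k) (Finset.mem_univ k)
      linarith
    rw [Real.dist_eq, piP, ← sub_div, abs_div, abs_of_pos hp, div_lt_iff₀ hp]
    rw [div_lt_iff₀ hδ] at hlt
    linarith
  have h := hunif hdist (Sfun_piP ha hS)
  have h' : dist (ψ (piP α l (piP α l η₁))) (ψ (piP α l η₂)) < ε := by
    rw [← piP_dilation ha hS η₂]
    exact h
  have hidem : piP α l (piP α l η₁) = piP α l η₁ := piP_dilation ha hS η₁
  rw [hidem, dist_eq_norm] at h'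
  exact h'.le

end
end
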